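/- Let A be a unital commutative k-algebra. The λ-TD shuffle product ⧢ on Ш(A) = ⊕_{n≥0} A^{⊗n} is associative: (𝔞 ⧢ 𝔟) ⧢ 𝔠 = 𝔞 ⧢ (𝔟 ⧢ 𝔠) for all 𝔞, 𝔟, 𝔠 ∈ Ш(A). -/

import Mathlib

/-!
Common setup: the `λ`-TD shuffle product on `Ш(A) = ⊕_{n ≥ 0} A^{⊗n}` over a commutative
ring `k`, where `A` is a unital commutative `k`-algebra and `A^{⊗0} = k`.  Pure tensors of
positive length are written `Fin.cons a f`, the operation "prepend `a`", i.e. `a ⊗ (–)`,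
is implemented as multiplication by the degree-one element `shIota k A a` in the graded
(concatenation) algebra `⊕_{n ≥ 0} A^{⊗n}`.
-/

open scoped TensorProduct DirectSum
open PiTensorProduct

noncomputable section

variable (k A : Type*) [CommRing k] [CommRing A] [Algebra k A]

/-- The shuffle module `Ш(A) = ⊕_{n ≥ 0} A^{⊗n}` (with `A^{⊗0} = k`). -/
abbrev ShuffleModule : Type _ := ⨁ n : ℕ, ⨂[k]^n A

/-- The pure tensor `a₁ ⊗ ⋯ ⊗ aₙ ∈ A^{⊗n} ⊆ Ш(A)`. -/
def shEmb {n : ℕ} (f : Fin n → A) : ShuffleModule k A :=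
  DirectSum.lof k ℕ (fun n => ⨂[k]^n A) n (tprod k f)

/-- The inclusion of `A^{⊗0} = k` into `Ш(A)`. -/
def shDeg0 (v : ⨂[k]^0 A) : ShuffleModule k A :=
  DirectSum.lof k ℕ (fun n => ⨂[k]^n A) 0 v

/-- Length-one pure tensors, as a linear map `A →ₗ[k] Ш(A)`. -/
def shIota : A →ₗ[k] ShuffleModule k A :=
  (DirectSum.lof k ℕ (fun n => ⨂[k]^n A) 1).comp
    ((MultilinearMap.ofSubsingleton k A (⨂[k]^1 A) (0 : Fin 1)).symm (tprod k))

/-- The element `1_A ∈ A ⊆ Ш(A)`. -/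
def shOneA : ShuffleModule k A := shIota k A (1 : A)

variable (lam : k)

/-- `sh` is the `λ`-TD shuffle product on `Ш(A) = ⊕_{n≥0} A^{⊗n}`: it is `k`-bilinear, acts
by scalar multiplication when one of the arguments lies in `A^{⊗0} = k`, and for pure tensors
`𝔞 = a₁ ⊗ 𝔞'`, `𝔟 = b₁ ⊗ 𝔟'` of positive lengths it satisfies the recursion
`𝔞 ⧢ 𝔟 = a₁ ⊗ (𝔞' ⧢ 𝔟) + b₁ ⊗ (𝔞 ⧢ 𝔟') + λ·a₁b₁ ⊗ (𝔞' ⧢ 𝔟') − a₁b₁ ⊗ ((𝔞' ⧢ 1_A) ⧢ 𝔟')`. -/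
structure IsLambdaTDShuffle
    (sh : ShuffleModule k A →ₗ[k] ShuffleModule k A →ₗ[k] ShuffleModule k A) : Prop where
  scalar_left : ∀ (v : ⨂[k]^0 A) (x : ShuffleModule k A),
    sh (shDeg0 k A v) x = (isEmptyEquiv (Fin 0) v) • x
  scalar_right : ∀ (v : ⨂[k]^0 A) (x : ShuffleModule k A),
    sh x (shDeg0 k A v) = (isEmptyEquiv (Fin 0) v) • x
  shuffle_rec : ∀ {m n : ℕ} (a b : A) (f : Fin m → A) (g : Fin n → A),
    sh (shEmb k A (Fin.cons a f)) (shEmb k A (Fin.cons b g)) =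
      shIota k A a * sh (shEmb k A f) (shEmb k A (Fin.cons b g))
      + shIota k A b * sh (shEmb k A (Fin.cons a f)) (shEmb k A g)
      + lam • (shIota k A (a * b) * sh (shEmb k A f) (shEmb k A g))
      - shIota k A (a * b) * sh (sh (shEmb k A f) (shOneA k A)) (shEmb k A g)

end

noncomputable section
variable {k A : Type*} [CommRing k] [CommRing A] [Algebra k A] {lam : k}

/-- Prepending a letter is multiplication by `shIota` in the concatenation algebra. -/
theorem shIota_mul_shEmb {n : ℕ} (a : A) (f : Fin n → A) :
    shIota k A a * shEmb k A f = shEmb k A (Fin.cons a f : Fin (n + 1) → A) := by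
  change DirectSum.of (fun n => ⨂[k]^n A) 1 (tprod k fun _ => a) *
    DirectSum.of (fun n => ⨂[k]^n A) n (tprod k f) =
      DirectSum.of (fun n => ⨂[k]^n A) (n + 1) (tprod k (Fin.cons a f))
  rw [DirectSum.of_mul_of]
  apply DirectSum.of_eq_of_gradedMonoid_eq
  refine TensorPower.gradedMonoid_eq_of_cast (Nat.add_comm 1 n) ?_
  rw [TensorPower.tprod_mul_tprod]
  refine (TensorPower.cast_tprod k A _ _).trans ?_
  congr 1
  funext i
  exact congrFun (Fin.append_left_eq_cons (fun _ : Fin 1 => a) f) (Fin.cast (Nat.add_comm n 1) i)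

theorem shEmb_of_isEmpty (f : Fin 0 → A) : shEmb k A f = 1 := by
  rw [Subsingleton.elim f Fin.elim0]
  rfl

theorem shIota_one_mul_one : shIota k A 1 * 1 = shOneA k A := mul_one _

variable (k A) in
/-- The span of the pure tensors of length at most `n`. -/
def shFiltration (n : ℕ) : Submodule k (ShuffleModule k A) :=
  Submodule.span k {x | ∃ m ≤ n, ∃ f : Fin m → A, shEmb k A f = x}

theorem shEmb_mem_shFiltration {m n : ℕ} (h : m ≤ n) (f : Fin m → A) :
    shEmb k A f ∈ shFiltration k A n :=
  Submodule.subset_span ⟨m, h, f, rfl⟩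

theorem shFiltration_mono : Monotone (shFiltration k A) := fun _ _ h =>
  Submodule.span_mono fun _ ⟨m, hm, hf⟩ => ⟨m, hm.trans h, hf⟩

theorem one_mem_shFiltration (n : ℕ) : (1 : ShuffleModule k A) ∈ shFiltration k A n :=
  shEmb_of_isEmpty (k := k) (A := A) Fin.elim0 ▸ shEmb_mem_shFiltration n.zero_le _

theorem shIota_mul_mem_shFiltration {n : ℕ} (a : A) {x : ShuffleModule k A}
    (hx : x ∈ shFiltration k A n) : shIota k A a * x ∈ shFiltration k A (n + 1) := by
  induction hx using Submodule.span_induction with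
  | mem x hx =>
    obtain ⟨m, hm, f, rfl⟩ := hx
    rw [shIota_mul_shEmb]
    exact shEmb_mem_shFiltration (by omega) _
  | zero => simp
  | add x y _ _ hx hy => rw [mul_add]; exact add_mem hx hy
  | smul c x _ hx => rw [mul_smul_comm]; exact Submodule.smul_mem _ _ hx

theorem shOneA_mem_shFiltration : shOneA k A ∈ shFiltration k A 1 :=
  shIota_one_mul_one (k := k) (A := A) ▸
    shIota_mul_mem_shFiltration 1 (one_mem_shFiltration 0)

theorem exists_mem_shFiltration (x : ShuffleModule k A) : ∃ n, x ∈ shFiltration k A n := by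
  induction x using DirectSum.induction_on with
  | zero => exact ⟨0, zero_mem _⟩
  | of n x =>
    refine ⟨n, ?_⟩
    change DirectSum.lof k ℕ (fun n => ⨂[k]^n A) n x ∈ _
    induction x using PiTensorProduct.induction_on with
    | smul_tprod c f =>
      rw [map_smul]
      exact Submodule.smul_mem _ _ (shEmb_mem_shFiltration le_rfl f)
    | add x y hx hy => rw [map_add]; exact add_mem hx hy
  | add x y hx hy =>
    obtain ⟨m, hm⟩ := hx
    obtain ⟨n, hn⟩ := hy
    exact ⟨max m n, add_mem (shFiltration_mono (le_max_left m n) hm)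
      (shFiltration_mono (le_max_right m n) hn)⟩

/-- A submodule contains the `n`-th filtration step as soon as it contains `1` and every
`a ⊗ y` of length at most `n`. -/
theorem shFiltration_le {n : ℕ} {S : Submodule k (ShuffleModule k A)} (one : 1 ∈ S)
    (cons : ∀ m, m + 1 ≤ n → ∀ a, ∀ y ∈ shFiltration k A m, shIota k A a * y ∈ S) :
    shFiltration k A n ≤ S := by
  refine Submodule.span_le.2 ?_
  rintro _ ⟨m, hm, f, rfl⟩
  cases m with
  | zero => rwa [shEmb_of_isEmpty]
  | succ m =>
    rw [← Fin.cons_self_tail f, ← shIota_mul_shEmb]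
    exact cons m hm _ _ (shEmb_mem_shFiltration le_rfl _)

/-- Two linear maps agree on the `n`-th filtration step as soon as they agree on `1` and on every
`a ⊗ y` of length at most `n`. -/
theorem eqOn_shFiltration {M : Type*} [AddCommMonoid M] [Module k M] {n : ℕ}
    {F G : ShuffleModule k A →ₗ[k] M} (one : F 1 = G 1)
    (cons : ∀ m, m + 1 ≤ n → ∀ a, ∀ y ∈ shFiltration k A m,
      F (shIota k A a * y) = G (shIota k A a * y))
    {x : ShuffleModule k A} (hx : x ∈ shFiltration k A n) : F x = G x :=
  shFiltration_le (S := LinearMap.eqLocus F G) one cons hx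

/-- Linear maps agreeing on all pure tensors are equal. -/
theorem linearMap_ext_shEmb {M : Type*} [AddCommMonoid M] [Module k M]
    {F G : ShuffleModule k A →ₗ[k] M}
    (h : ∀ {m : ℕ} (f : Fin m → A), F (shEmb k A f) = G (shEmb k A f)) : F = G := by
  ext n f
  exact h f

namespace IsLambdaTDShuffle

variable {sh : ShuffleModule k A →ₗ[k] ShuffleModule k A →ₗ[k] ShuffleModule k A}

theorem one_left (hsh : IsLambdaTDShuffle k A lam sh) (x : ShuffleModule k A) : sh 1 x = x := by
  have h := hsh.scalar_left (tprod k Fin.elim0) x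
  rw [isEmptyEquiv_apply_tprod, one_smul] at h
  exact h

theorem one_right (hsh : IsLambdaTDShuffle k A lam sh) (x : ShuffleModule k A) : sh x 1 = x := by
  have h := hsh.scalar_right (tprod k Fin.elim0) x
  rw [isEmptyEquiv_apply_tprod, one_smul] at h
  exact h

/-- The recursion, extended from pure tensors to arbitrary tails. -/
theorem cons_cons (hsh : IsLambdaTDShuffle k A lam sh) (a b : A) (x y : ShuffleModule k A) :
    sh (shIota k A a * x) (shIota k A b * y) =
      shIota k A a * sh x (shIota k A b * y) + shIota k A b * sh (shIota k A a * x) y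
      + lam • (shIota k A (a * b) * sh x y)
      - shIota k A (a * b) * sh (sh x (shOneA k A)) y := by
  let L : A → ShuffleModule k A →ₗ[k] ShuffleModule k A := fun c =>
    LinearMap.mulLeft k (shIota k A c)
  have key : sh.compl₁₂ (L a) (L b) + (sh.comp (sh.flip (shOneA k A))).compr₂ (L (a * b)) =
      (sh.compl₂ (L b)).compr₂ (L a) + (sh.comp (L a)).compr₂ (L b)
      + lam • sh.compr₂ (L (a * b)) := by
    refine linearMap_ext_shEmb fun f => linearMap_ext_shEmb fun g => ?_
    simpa [L, shIota_mul_shEmb, eq_sub_iff_add_eq] using hsh.shuffle_rec a b f g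
  simpa [L, eq_sub_iff_add_eq] using LinearMap.congr_fun₂ key x y

/-- The element `1_A` is central. -/
theorem shOneA_comm (hsh : IsLambdaTDShuffle k A lam sh) (x : ShuffleModule k A) :
    sh (shOneA k A) x = sh x (shOneA k A) := by
  obtain ⟨n, hn⟩ := exists_mem_shFiltration x
  refine eqOn_shFiltration (F := sh (shOneA k A)) (G := sh.flip (shOneA k A)) ?_ ?_ hn
  · simp [hsh.one_left, hsh.one_right]
  · intro m _ a y _
    rw [LinearMap.flip_apply, ← shIota_one_mul_one, hsh.cons_cons, hsh.cons_cons]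
    simp only [shOneA, hsh.one_left, hsh.one_right, one_mul, mul_one]
    abel

theorem mem_shFiltration (hsh : IsLambdaTDShuffle k A lam sh) {m n : ℕ} {x y : ShuffleModule k A}
    (hx : x ∈ shFiltration k A m) (hy : y ∈ shFiltration k A n) :
    sh x y ∈ shFiltration k A (m + n) := by
  induction hN : m + n using Nat.strong_induction_on generalizing m n x y with
  | _ N ih =>
  subst hN
  have IH {i j p : ℕ} {v w : ShuffleModule k A} (hv : v ∈ shFiltration k A i)
      (hw : w ∈ shFiltration k A j) (h : i + j < m + n) (hp : i + j ≤ p) :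
      sh v w ∈ shFiltration k A p :=
    shFiltration_mono hp (ih _ h hv hw rfl)
  suffices h : shFiltration k A m ≤ (shFiltration k A (m + n)).comap (sh.flip y) from h hx
  refine shFiltration_le ?_ fun i hi a v hv => ?_
  · simpa [hsh.one_left] using shFiltration_mono (Nat.le_add_left n m) hy
  suffices h : shFiltration k A n ≤
      (shFiltration k A (m + n)).comap (sh (shIota k A a * v)) from h hy
  have hav := shIota_mul_mem_shFiltration a hv
  refine shFiltration_le ?_ fun j hj b w hw => ?_
  · simpa [hsh.one_right] using shFiltration_mono (by omega) hav
  have hbw := shIota_mul_mem_shFiltration b hw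
  have cons (c : A) {t : ShuffleModule k A} (ht : t ∈ shFiltration k A (i + j + 1)) :
      shIota k A c * t ∈ shFiltration k A (m + n) :=
    shFiltration_mono (by omega) (shIota_mul_mem_shFiltration c ht)
  rw [Submodule.mem_comap, hsh.cons_cons]
  refine sub_mem (add_mem (add_mem (cons _ ?_) (cons _ ?_))
    (Submodule.smul_mem _ _ (cons _ ?_))) (cons _ ?_)
  · exact IH hv hbw (by omega) (by omega)
  · exact IH hav hw (by omega) (by omega)
  · exact IH hv hw (by omega) (by omega)
  · exact IH (IH hv shOneA_mem_shFiltration (by omega) le_rfl) hw (by omega) (by omega)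

theorem assoc_of_mem_shFiltration (hsh : IsLambdaTDShuffle k A lam sh) {l m n : ℕ}
    {x y z : ShuffleModule k A} (hx : x ∈ shFiltration k A l) (hy : y ∈ shFiltration k A m)
    (hz : z ∈ shFiltration k A n) : sh (sh x y) z = sh x (sh y z) := by
  induction hN : l + m + n using Nat.strong_induction_on generalizing l m n x y z with
  | _ N ih =>
  subst hN
  refine eqOn_shFiltration (F := (sh.flip z).comp (sh.flip y)) (G := sh.flip (sh y z))
    ?_ (fun i hi a x hx => ?_) hx
  · simp [hsh.one_left]
  refine eqOn_shFiltration (F := (sh.flip z).comp (sh (shIota k A a * x)))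
    (G := (sh (shIota k A a * x)).comp (sh.flip z)) ?_ (fun j hj b y hy => ?_) hy
  · simp [hsh.one_left, hsh.one_right]
  refine eqOn_shFiltration (F := sh (sh (shIota k A a * x) (shIota k A b * y)))
    (G := (sh (shIota k A a * x)).comp (sh (shIota k A b * y))) ?_ (fun p hp c z hz => ?_) hz
  · simp [hsh.one_right]
  have IH {q r s : ℕ} {t v w : ShuffleModule k A} (ht : t ∈ shFiltration k A q)
      (hv : v ∈ shFiltration k A r) (hw : w ∈ shFiltration k A s)
      (h : q + r + s ≤ i + j + p + 2) : sh (sh t v) w = sh t (sh v w) :=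
    ih _ (by omega) ht hv hw rfl
  have hu := shOneA_mem_shFiltration (k := k) (A := A)
  have hax := shIota_mul_mem_shFiltration a hx
  have hby := shIota_mul_mem_shFiltration b hy
  have hcz := shIota_mul_mem_shFiltration c hz
  -- Moving `1_A` across the middle factor of a product.
  have swap {q r s : ℕ} {t v w : ShuffleModule k A} (ht : t ∈ shFiltration k A q)
      (hv : v ∈ shFiltration k A r) (hw : w ∈ shFiltration k A s)
      (h : q + r + s ≤ i + j + p + 1) :
      sh (sh (sh t v) (shOneA k A)) w = sh (sh t (shOneA k A)) (sh v w) := by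
    rw [IH ht hv hu (by omega), ← hsh.shOneA_comm v, ← IH ht hu hv (by omega),
      IH (hsh.mem_shFiltration ht hu) hv hw (by omega)]
  have hxu := hsh.mem_shFiltration hx hu
  have hyu := hsh.mem_shFiltration hy hu
  change sh (sh (shIota k A a * x) (shIota k A b * y)) (shIota k A c * z) =
    sh (shIota k A a * x) (sh (shIota k A b * y) (shIota k A c * z))
  have e₁ := IH hx hby hcz (by omega)
  have e₂ := IH hax hy hcz (by omega)
  have e₃ := IH hax hby hz (by omega)
  have e₄ := IH hx hby hz (by omega)
  have e₅ := swap hx hby hz (by omega)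
  have e₆ := IH hax hy hz (by omega)
  have e₇ : sh (sh (sh (shIota k A a * x) y) (shOneA k A)) z =
      sh (shIota k A a * x) (sh (sh y (shOneA k A)) z) := by
    rw [IH hax hy hu (by omega), IH hax hyu hz (by omega)]
  have e₈ := IH hx hy hcz (by omega)
  have e₉ := IH hxu hy hcz (by omega)
  have e₁₀ := IH hx hy hz (by omega)
  have e₁₁ : sh (sh (sh x y) (shOneA k A)) z = sh x (sh (sh y (shOneA k A)) z) := by
    rw [IH hx hy hu (by omega), IH hx hyu hz (by omega)]
  have e₁₂ := IH hxu hy hz (by omega)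
  have e₁₃ : sh (sh (sh (sh x (shOneA k A)) y) (shOneA k A)) z =
      sh (sh x (shOneA k A)) (sh (sh y (shOneA k A)) z) := by
    rw [IH hxu hy hu (by omega), IH hxu hyu hz (by omega)]
  have h₁ := congrArg (shIota k A a * ·) e₁
  have h₃ := congrArg (shIota k A c * ·) e₃
  simp only [map_add, map_sub, map_smul, LinearMap.add_apply, LinearMap.sub_apply,
    LinearMap.smul_apply, hsh.cons_cons, mul_add, mul_sub, mul_smul_comm, smul_add, smul_sub,
    mul_assoc, e₂, e₄, e₅, e₆, e₇, e₈, e₉, e₁₀, e₁₁, e₁₂, e₁₃] at h₁ h₃ ⊢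
  linear_combination (norm := module) h₁ + h₃

end IsLambdaTDShuffle

/-- The `λ`-TD shuffle product `⧢` on `Ш(A) = ⊕_{n≥0} A^{⊗n}` is
associative: `(𝔞 ⧢ 𝔟) ⧢ 𝔠 = 𝔞 ⧢ (𝔟 ⧢ 𝔠)` for all `𝔞, 𝔟, 𝔠 ∈ Ш(A)`. -/
theorem lambdaTDShuffle_assoc
    (sh : ShuffleModule k A →ₗ[k] ShuffleModule k A →ₗ[k] ShuffleModule k A)
    (hsh : IsLambdaTDShuffle k A lam sh) :
    ∀ x y z : ShuffleModule k A, sh (sh x y) z = sh x (sh y z) := by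
  intro x y z
  obtain ⟨l, hl⟩ := exists_mem_shFiltration x
  obtain ⟨m, hm⟩ := exists_mem_shFiltration y
  obtain ⟨n, hn⟩ := exists_mem_shFiltration z
  exact hsh.assoc_of_mem_shFiltration hl hm hn

end
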